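/- Fix a natural number M ≥ 1 and let f_m(x) = sin(2πmx) for m = 1, …, M. The set of locally controllable states {x ∈ (0,1) : ∃ m₁, m₂ ∈ {1, …, M}, f_{m₁}(x) · f_{m₂}(x) < 0} has Lebesgue measure 1 − 1/M. In particular the local controllability ratio for a single particle with M ideal 1D modes is R(M, 1) = 1 − 1/M. -/

import Mathlib

open Real MeasureTheory

/-- Some mode of index at most `M` is negative at `x` once `1 / (2M) < x`. -/
lemma exists_sin_two_pi_mul_neg {M : ℕ} {x : ℝ} (hx : x < 1 / 2) (hMx : 1 < 2 * M * x) :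
    ∃ m : ℕ, 1 ≤ m ∧ m ≤ M ∧ Real.sin (2 * π * m * x) < 0 := by
  have hex : ∃ m : ℕ, 1 < 2 * m * x := ⟨M, hMx⟩
  obtain ⟨k, hk⟩ : ∃ k, Nat.find hex = k + 1 := by
    refine Nat.exists_eq_succ_of_ne_zero fun h => ?_
    have := Nat.find_spec hex
    rw [h] at this
    norm_num at this
  have h1 : 1 < 2 * ((k + 1 : ℕ) : ℝ) * x := hk ▸ Nat.find_spec hex
  have h2 : 2 * (k : ℝ) * x ≤ 1 := not_lt.1 (Nat.find_min hex (by lia))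
  refine ⟨k + 1, by lia, hk ▸ Nat.find_min' hex hMx, ?_⟩
  push_cast at h1 ⊢
  have hpi := Real.pi_pos
  rw [← Real.sin_sub_two_pi]
  apply Real.sin_neg_of_neg_of_neg_pi_lt <;> nlinarith

lemma exists_sin_mul_sin_neg_iff {M : ℕ} (hM : 1 ≤ M) {x : ℝ} (hx0 : 0 < x) (hx : x < 1 / 2) :
    (∃ m₁ m₂ : ℕ, 1 ≤ m₁ ∧ m₁ ≤ M ∧ 1 ≤ m₂ ∧ m₂ ≤ M ∧
      Real.sin (2 * π * m₁ * x) * Real.sin (2 * π * m₂ * x) < 0) ↔ 1 < 2 * M * x := by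
  have hpi := Real.pi_pos
  constructor
  · rintro ⟨m₁, m₂, -, h₁, -, h₂, h⟩
    by_contra! hMx
    have nonneg (m : ℕ) (hm : m ≤ M) : 0 ≤ Real.sin (2 * π * m * x) := by
      apply Real.sin_nonneg_of_nonneg_of_le_pi (by positivity)
      have : (m : ℝ) * x ≤ M * x := by gcongr
      nlinarith
    exact h.not_ge (mul_nonneg (nonneg m₁ h₁) (nonneg m₂ h₂))
  · intro hMx
    obtain ⟨m, hm1, hm, hneg⟩ := exists_sin_two_pi_mul_neg hx hMx
    refine ⟨1, m, le_rfl, hM, hm1, hm, mul_neg_of_pos_of_neg ?_ hneg⟩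
    apply Real.sin_pos_of_pos_of_lt_pi <;> push_cast
    · positivity
    · nlinarith

lemma sin_two_pi_mul_one_sub (m : ℕ) (x : ℝ) :
    Real.sin (2 * π * m * (1 - x)) = -Real.sin (2 * π * m * x) := by
  rw [← Real.sin_nat_mul_two_pi_sub _ m]
  ring_nf

lemma sin_two_pi_mul_half (m : ℕ) : Real.sin (2 * π * m * (1 / 2)) = 0 := by
  rw [← Real.sin_nat_mul_pi m]
  ring_nf

lemma locallyControllable_eq_union {M : ℕ} (hM : 1 ≤ M) :
    {x : ℝ | x ∈ Set.Ioo (0 : ℝ) 1 ∧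
        ∃ m₁ m₂ : ℕ, 1 ≤ m₁ ∧ m₁ ≤ M ∧ 1 ≤ m₂ ∧ m₂ ≤ M ∧
          Real.sin (2 * π * m₁ * x) * Real.sin (2 * π * m₂ * x) < 0} =
      Set.Ioo (1 / (2 * M) : ℝ) (1 / 2) ∪ Set.Ioo (1 / 2 : ℝ) (1 - 1 / (2 * M)) := by
  have hM0 : (0 : ℝ) < 2 * M := by positivity
  have hinv : (0 : ℝ) < 1 / (2 * M) := by positivity
  have hdiv (y : ℝ) : 1 / (2 * M) < y ↔ 1 < 2 * M * y := div_lt_iff₀' hM0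
  ext x
  simp only [Set.mem_ofPred_eq, Set.mem_union, Set.mem_Ioo]
  rcases lt_trichotomy x (1 / 2) with hx | rfl | hx
  · rw [hdiv x]
    constructor
    · rintro ⟨⟨h0, -⟩, h⟩
      exact .inl ⟨(exists_sin_mul_sin_neg_iff hM h0 hx).1 h, hx⟩
    · rintro (⟨h, -⟩ | ⟨h, -⟩)
      · have h0 : 0 < x := hinv.trans ((hdiv x).2 h)
        exact ⟨⟨h0, by linarith⟩, (exists_sin_mul_sin_neg_iff hM h0 hx).2 h⟩
      · linarith
  · simp only [sin_two_pi_mul_half, lt_irrefl, mul_zero, and_false, false_and, exists_false,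
      or_self]
  · have key (h1 : x < 1) := exists_sin_mul_sin_neg_iff hM (x := 1 - x) (by linarith) (by linarith)
    simp only [sin_two_pi_mul_one_sub, neg_mul_neg, ← hdiv] at key
    constructor
    · rintro ⟨⟨-, h1⟩, h⟩
      exact .inr ⟨hx, by linarith [(key h1).1 h]⟩
    · rintro (⟨-, h⟩ | ⟨-, h⟩)
      · linarith
      · have h1 : x < 1 := by linarith
        exact ⟨⟨by linarith, h1⟩, (key h1).2 (by linarith)⟩

/-- In the ideal 1D acoustophoresis model with modes `f_m(x) = sin(2πmx)`, `m = 1, …, M`,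
the set of locally controllable states in `(0,1)` has Lebesgue measure `1 - 1/M`,
i.e. the local controllability ratio is `R(M,1) = 1 - 1/M`. -/
theorem measure_locallyControllable_eq (M : ℕ) (hM : 1 ≤ M) :
    volume {x : ℝ | x ∈ Set.Ioo (0 : ℝ) 1 ∧
        ∃ m₁ m₂ : ℕ, 1 ≤ m₁ ∧ m₁ ≤ M ∧ 1 ≤ m₂ ∧ m₂ ≤ M ∧
          Real.sin (2 * π * m₁ * x) * Real.sin (2 * π * m₂ * x) < 0} =
      ENNReal.ofReal (1 - 1 / M) := by
  have hM' : (1 : ℝ) ≤ M := by exact_mod_cast hM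
  have hle : 1 / (2 * M : ℝ) ≤ 1 / 2 := by
    apply one_div_le_one_div_of_le <;> linarith
  have hdisj : Disjoint (Set.Ioo (1 / (2 * M) : ℝ) (1 / 2))
      (Set.Ioo (1 / 2 : ℝ) (1 - 1 / (2 * M))) :=
    Set.disjoint_left.2 fun x h h' => lt_asymm h.2 h'.1
  rw [locallyControllable_eq_union hM, measure_union hdisj measurableSet_Ioo, Real.volume_Ioo,
    Real.volume_Ioo, ← ENNReal.ofReal_add (by linarith) (by linarith)]
  congr 1
  field_simp
  ring
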